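/- arXiv:1912.10439 — 2 statements merged into one kernel-verified Lean document; each statement's English description precedes it below -/
import Mathlib

section
/- Let D be a locally compact, rectifiably connected noncomplete metric space that is a-John, and suppose (D,k) is K-roughly starlike and δ-hyperbolic, where k is the quasihyperbolic metric. Then every quasihyperbolic geodesic in D is a b-cone arc, where b depends only on a, δ and K. -/
open Set Metric

noncomputable section

variable {D : Type*} [MetricSpace D]

/-- Distance from a point to the metric boundary `∂D = D̄ \ D`. -/
def dB (x : D) : ℝ :=
  Metric.infDist (x : UniformSpace.Completion D)
    ((Set.range ((↑) : D → UniformSpace.Completion D))ᶜ)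

/-- A rectifiable curve from `x` to `y`, given in (1-Lipschitz) arclength
parametrization on `[0, L]`; `L` is its length. -/
structure Curve (D : Type*) [MetricSpace D] (x y : D) where
  L : ℝ
  hL : 0 ≤ L
  γ : ℝ → D
  lip : LipschitzOnWith 1 γ (Set.Icc 0 L)
  h0 : γ 0 = x
  h1 : γ L = y

/-- Quasihyperbolic length of the subarc with parameters in `[s,t]`. -/
def Curve.qhLenOn {x y : D} (c : Curve D x y) (s t : ℝ) : ℝ :=
  ∫ u in s..t, 1 / dB (c.γ u)

/-- Quasihyperbolic length of a curve. -/
def Curve.qhLen {x y : D} (c : Curve D x y) : ℝ := c.qhLenOn 0 c.L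

/-- The quasihyperbolic distance: infimum of quasihyperbolic lengths of curves. -/
def qhDist (x y : D) : ℝ := sInf {r : ℝ | ∃ c : Curve D x y, r = c.qhLen}

/-- Every pair of points is joined by a rectifiable curve. -/
def RectConnected (D : Type*) [MetricSpace D] : Prop :=
  ∀ x y : D, Nonempty (Curve D x y)

/-- A length space: distance is the infimum of lengths of joining curves. -/
def IsLengthSpace (D : Type*) [MetricSpace D] : Prop :=
  ∀ x y : D, ∀ ε > 0, ∃ c : Curve D x y, c.L ≤ dist x y + ε

/-- A quasihyperbolic geodesic. -/
def Curve.IsQHGeodesic {x y : D} (c : Curve D x y) : Prop :=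
  ∀ s t : ℝ, s ∈ Set.Icc 0 c.L → t ∈ Set.Icc 0 c.L → s ≤ t →
    c.qhLenOn s t = qhDist (c.γ s) (c.γ t)

/-- An `a`-cone arc: `min{ℓ(α[x,z]), ℓ(α[z,y])} ≤ a·d_D(z)` for all `z` on the arc. -/
def Curve.IsConeArc {x y : D} (c : Curve D x y) (a : ℝ) : Prop :=
  ∀ t ∈ Set.Icc 0 c.L, min t (c.L - t) ≤ a * dB (c.γ t)

/-- A `(λ,μ)`-quasigeodesic with respect to the quasihyperbolic metric. -/
def Curve.IsQuasigeodesic {x y : D} (c : Curve D x y) (lam mu : ℝ) : Prop :=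
  ∀ s t : ℝ, s ∈ Set.Icc 0 c.L → t ∈ Set.Icc 0 c.L → s ≤ t →
    c.qhLenOn s t ≤ lam * qhDist (c.γ s) (c.γ t) + mu

/-- An `a`-John space. -/
def IsJohn (D : Type*) [MetricSpace D] (a : ℝ) : Prop :=
  ∀ x y : D, ∃ c : Curve D x y, c.IsConeArc a

/-- A `c`-uniform space. -/
def IsUniform (D : Type*) [MetricSpace D] (c : ℝ) : Prop :=
  ∀ x y : D, ∃ α : Curve D x y, α.L ≤ c * dist x y ∧ α.IsConeArc c

/-- Gromov product with respect to the quasihyperbolic metric. -/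
def gromovProd (x y w : D) : ℝ := (qhDist x w + qhDist y w - qhDist x y) / 2

/-- `(D,k)` is Gromov `δ`-hyperbolic (four-point condition). -/
def QHHyperbolic (D : Type*) [MetricSpace D] (δ : ℝ) : Prop :=
  ∀ x y z w : D, min (gromovProd x y w) (gromovProd y z w) - δ ≤ gromovProd x z w

/-- `(D,k)` is `K`-roughly starlike with respect to `w`. -/
def RoughlyStarlike (D : Type*) [MetricSpace D] (K : ℝ) (w : D) : Prop :=
  ∀ x : D, ∃ γ : ℝ → D, γ 0 = w ∧
    (∀ s t : ℝ, 0 ≤ s → 0 ≤ t → qhDist (γ s) (γ t) = |s - t|) ∧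
    ∃ t : ℝ, 0 ≤ t ∧ qhDist x (γ t) ≤ K

/-- The `h`-coarse quasihyperbolic length of the part of the curve `β` with
parameters in `[s,t]`. -/
def coarseLen {E : Type*} [MetricSpace E] (β : ℝ → E) (s t h : ℝ) : ℝ :=
  sSup {r : ℝ | ∃ n : ℕ, ∃ u : Fin (n + 1) → ℝ, Monotone u ∧
    (∀ i, u i ∈ Set.Icc s t) ∧
    (∀ i : Fin n, h ≤ qhDist (β (u i.castSucc)) (β (u i.succ))) ∧
    r = ∑ i : Fin n, qhDist (β (u i.castSucc)) (β (u i.succ))}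

/-- `λ`-annular quasiconvexity. -/
def AnnularQuasiconvex (X : Type*) [MetricSpace X] (lam : ℝ) : Prop :=
  ∀ (x : X) (r r' : ℝ), 0 < r' → r' < r →
    ∀ y z : X, y ∈ Metric.ball x r \ Metric.ball x r' →
      z ∈ Metric.ball x r \ Metric.ball x r' →
      ∃ c : Curve X y z, c.L ≤ lam * dist y z ∧
        ∀ t ∈ Set.Icc 0 c.L, c.γ t ∈ Metric.ball x (lam * r) \ Metric.ball x (r' / lam)

end


theorem frink_chain {X : Type*} (G : X → X → ℝ) (hs : ∀ x y, G x y = G y x) (δ ε : ℝ)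
    (hδ : 0 ≤ δ) (hε : 0 < ε) (h2 : 2 * ε * δ ≤ Real.log 2)
    (hG : ∀ x y z, min (G x y) (G y z) - δ ≤ G x z) (p : ℕ → X) (n : ℕ) (hp : p 0 ≠ p n) :
    Real.exp (-ε * G (p 0) (p n)) ≤
      2 * ∑ j ∈ Finset.range n, Real.exp (-ε * G (p j) (p (j + 1))) := by
  classical
  let d : X → X → NNReal := fun x y =>
    if x = y then 0 else ⟨Real.exp (-ε * G x y), (Real.exp_pos _).le⟩
  have dne : ∀ x y, x ≠ y → (d x y : ℝ) = Real.exp (-ε * G x y) := by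
    intro x y h
    have h' : d x y = ⟨Real.exp (-ε * G x y), (Real.exp_pos _).le⟩ := if_neg h
    rw [h']; rfl
  have dle : ∀ x y, (d x y : ℝ) ≤ Real.exp (-ε * G x y) := by
    intro x y
    by_cases h : x = y
    · simp [d, h, (Real.exp_pos _).le]
    · exact (dne x y h).le
  have dself : ∀ x, d x x = 0 := by intro x; simp [d]
  have dcomm : ∀ x y, d x y = d y x := by
    intro x y
    by_cases h : x = y
    · subst h; rfl
    · apply NNReal.eq
      rw [dne x y h, dne y x (Ne.symm h), hs]
  -- one step
  let E : ℝ := Real.exp (ε * δ)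
  have hE1 : 1 ≤ E := Real.one_le_exp (by positivity)
  have hE2 : E * E ≤ 2 := by
    rw [← Real.exp_add]
    calc Real.exp (ε * δ + ε * δ) ≤ Real.exp (Real.log 2) := Real.exp_le_exp.2 (by linarith)
      _ = 2 := Real.exp_log (by norm_num)
  have step : ∀ x y z, (d x z : ℝ) ≤ E * max (d x y : ℝ) (d y z) := by
    intro x y z
    by_cases h : x = z
    · subst h; rw [dself]; simp; positivity
    by_cases h1 : x = y
    · subst h1
      rw [dself]
      have : (0:ℝ) ≤ d x z := (d x z).2
      simp only [NNReal.coe_zero, max_eq_right this]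
      nlinarith
    by_cases h3 : y = z
    · subst h3
      rw [dself]
      have : (0:ℝ) ≤ d x y := (d x y).2
      simp only [NNReal.coe_zero, max_eq_left this]
      nlinarith
    rw [dne _ _ h, dne _ _ h1, dne _ _ h3]
    have := hG x y z
    rcases min_cases (G x y) (G y z) with ⟨hm, _⟩ | ⟨hm, _⟩
    · calc _ ≤ E * Real.exp (-ε * G x y) := by
            rw [← Real.exp_add]; apply Real.exp_le_exp.2; rw [hm] at this; nlinarith
        _ ≤ _ := by gcongr; exact le_max_left _ _
    · calc _ ≤ E * Real.exp (-ε * G y z) := by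
            rw [← Real.exp_add]; apply Real.exp_le_exp.2; rw [hm] at this; nlinarith
        _ ≤ _ := by gcongr; exact le_max_right _ _
  have hd : ∀ x₁ x₂ x₃ x₄, d x₁ x₄ ≤ 2 * max (d x₁ x₂) (max (d x₂ x₃) (d x₃ x₄)) := by
    intro x₁ x₂ x₃ x₄
    rw [← NNReal.coe_le_coe]
    push_cast
    set m := max (d x₁ x₂ : ℝ) (max (d x₂ x₃ : ℝ) (d x₃ x₄)) with hm
    have m0 : 0 ≤ m := le_max_of_le_left (d x₁ x₂).2
    have a1 : (d x₁ x₂ : ℝ) ≤ m := le_max_left _ _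
    have a2 : (d x₂ x₃ : ℝ) ≤ m := (le_max_left _ _).trans (le_max_right _ _)
    have a3 : (d x₃ x₄ : ℝ) ≤ m := (le_max_right _ _).trans (le_max_right _ _)
    have b1 : (d x₂ x₄ : ℝ) ≤ E * m :=
      (step x₂ x₃ x₄).trans (mul_le_mul_of_nonneg_left (max_le a2 a3) (by linarith))
    have b2 : (d x₁ x₄ : ℝ) ≤ E * (E * m) :=
      (step x₁ x₂ x₄).trans (mul_le_mul_of_nonneg_left (max_le (by nlinarith) b1) (by linarith))
    nlinarith
  let _ := PseudoMetricSpace.ofPreNNDist d dself dcomm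
  have key := PseudoMetricSpace.le_two_mul_dist_ofPreNNDist d dself dcomm hd (p 0) (p n)
  rw [dne _ _ hp] at key
  refine key.trans ?_
  gcongr
  refine (dist_le_range_sum_dist p n).trans (Finset.sum_le_sum fun j _ => ?_)
  exact (PseudoMetricSpace.dist_ofPreNNDist_le d dself dcomm _ _).trans (dle _ _)

theorem exp_sum_bound (c : ℝ) (hc : 0 < c) : ∃ S : ℝ, 0 ≤ S ∧ ∀ (m : ℤ) (n : ℕ),
    ∑ j ∈ Finset.range n, Real.exp (-c * |(j : ℝ) - m|) ≤ S := by
  have hN : Summable fun n : ℕ => Real.exp (-c * n) := by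
    have := Real.summable_exp_nat_mul_iff (a := -c)
    simpa [mul_comm] using this.2 (by linarith)
  have hsum : Summable fun k : ℤ => Real.exp (-c * |(k : ℝ)|) := by
    apply Summable.of_nat_of_neg
    · simpa using hN
    · simpa using hN
  refine ⟨∑' k : ℤ, Real.exp (-c * |(k : ℝ)|), tsum_nonneg fun _ => (Real.exp_pos _).le, ?_⟩
  intro m n
  have : ∑ j ∈ Finset.range n, Real.exp (-c * |(j : ℝ) - m|) =
      ∑ k ∈ (Finset.range n).image (fun j : ℕ => (j : ℤ) - m), Real.exp (-c * |(k : ℝ)|) := by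
    rw [Finset.sum_image]
    · simp
    · intro x _ y _ h; simpa using h
  rw [this]
  exact hsum.sum_le_tsum _ fun _ _ => (Real.exp_pos _).le

theorem dB_pos' {D : Type*} [MetricSpace D] [LocallyCompactSpace D] (hc : ¬ CompleteSpace D)
    (x : D) : 0 < dB x := by
  have hne : ((Set.range ((↑) : D → UniformSpace.Completion D))ᶜ).Nonempty := by
    by_contra h
    rw [Set.not_nonempty_iff_eq_empty, Set.compl_empty_iff] at h
    apply hc
    have h2 : IsComplete (Set.range ((↑) : D → UniformSpace.Completion D)) := by
      rw [h]; exact isComplete_univ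
    have ui := (UniformSpace.Completion.isUniformEmbedding_coe D).isUniformInducing
    rw [completeSpace_iff_isComplete_univ]
    rw [← ui.isComplete_iff (s := Set.univ), Set.image_univ]
    exact h2
  unfold dB
  rw [← Metric.infDist_pos_iff_notMem_closure hne]
  obtain ⟨K, hK, hxK⟩ := exists_compact_mem_nhds x
  obtain ⟨r, hr, hrK⟩ := Metric.mem_nhds_iff.1 hxK
  intro hcl
  rw [Metric.mem_closure_iff] at hcl
  obtain ⟨y, hy, hxy⟩ := hcl r hr
  apply hy
  have hKc : IsClosed (((↑) : D → UniformSpace.Completion D) '' K) :=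
    (hK.image (UniformSpace.Completion.continuous_coe D)).isClosed
  have hyK : y ∈ ((↑) : D → UniformSpace.Completion D) '' K := by
    rw [← hKc.closure_eq, Metric.mem_closure_iff]
    intro e he
    have hd : 0 < min e (r - dist (x : UniformSpace.Completion D) y) := lt_min he (by linarith)
    obtain ⟨z, hz⟩ := UniformSpace.Completion.denseRange_coe.exists_dist_lt y hd
    refine ⟨z, ⟨z, hrK ?_, rfl⟩, hz.trans_le (min_le_left _ _)⟩
    rw [Metric.mem_ball, dist_comm, ← UniformSpace.Completion.dist_eq]
    have h1 := dist_triangle (x : UniformSpace.Completion D) y z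
    have h2 := hz.trans_le (min_le_right _ _)
    linarith
  exact Set.image_subset_range _ _ hyK

theorem dB_le {D : Type*} [MetricSpace D] (x y : D) : dB x ≤ dB y + dist x y := by
  unfold dB
  rw [← UniformSpace.Completion.dist_eq]
  exact Metric.infDist_le_infDist_add_dist

theorem dB_cont {D : Type*} [MetricSpace D] : Continuous (dB : D → ℝ) :=
  (Metric.continuous_infDist_pt _).comp (UniformSpace.Completion.continuous_coe D)

theorem inv_dB_contOn {D : Type*} [MetricSpace D] (hpos : ∀ x : D, 0 < dB x) {f : ℝ → D}
    {s t : ℝ} (hf : LipschitzOnWith 1 f (Set.Icc s t)) :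
    ContinuousOn (fun u => 1 / dB (f u)) (Set.Icc s t) :=
  continuousOn_const.div (dB_cont.comp_continuousOn hf.continuousOn) fun u _ => (hpos _).ne'

theorem inv_dB_int {D : Type*} [MetricSpace D] (hpos : ∀ x : D, 0 < dB x) {f : ℝ → D}
    {s t : ℝ} (hst : s ≤ t) (hf : LipschitzOnWith 1 f (Set.Icc s t)) :
    IntervalIntegrable (fun u => 1 / dB (f u)) MeasureTheory.volume s t := by
  apply ContinuousOn.intervalIntegrable
  rw [Set.uIcc_of_le hst]
  exact inv_dB_contOn hpos hf

theorem lip_dist {D : Type*} [MetricSpace D] {f : ℝ → D} {S : Set ℝ}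
    (hf : LipschitzOnWith 1 f S) {u v : ℝ} (hu : u ∈ S) (hv : v ∈ S) :
    dist (f u) (f v) ≤ |u - v| := by
  have := hf.dist_le_mul u hu v hv
  simpa [Real.dist_eq] using this

theorem lip_of_dist {D : Type*} [MetricSpace D] {f : ℝ → D} {S : Set ℝ}
    (h : ∀ u ∈ S, ∀ v ∈ S, u ≤ v → dist (f u) (f v) ≤ v - u) : LipschitzOnWith 1 f S := by
  apply LipschitzOnWith.of_dist_le_mul
  intro u hu v hv
  simp only [NNReal.coe_one, one_mul, Real.dist_eq]
  rcases le_total u v with huv | huv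
  · rw [abs_sub_comm, abs_of_nonneg (by linarith)]; exact h u hu v hv huv
  · rw [abs_of_nonneg (by linarith), dist_comm]; exact h v hv u hu huv

theorem qhLen_nonneg {D : Type*} [MetricSpace D] (hpos : ∀ x : D, 0 < dB x) {x y : D}
    (c : Curve D x y) : 0 ≤ c.qhLen :=
  intervalIntegral.integral_nonneg c.hL fun u _ => (one_div_pos.2 (hpos _)).le

theorem qh_bdd {D : Type*} [MetricSpace D] (hpos : ∀ x : D, 0 < dB x) (x y : D) :
    BddBelow {r : ℝ | ∃ c : Curve D x y, r = c.qhLen} :=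
  ⟨0, by rintro r ⟨c, rfl⟩; exact qhLen_nonneg hpos c⟩

theorem qh_le_int {D : Type*} [MetricSpace D] (hpos : ∀ x : D, 0 < dB x) {f : ℝ → D}
    {s t : ℝ} (hst : s ≤ t) (hf : LipschitzOnWith 1 f (Set.Icc s t)) :
    qhDist (f s) (f t) ≤ ∫ u in s..t, 1 / dB (f u) := by
  let c : Curve D (f s) (f t) :=
    { L := t - s
      hL := by linarith
      γ := fun u => f (s + u)
      lip := by
        apply lip_of_dist
        rintro u ⟨hu, hu'⟩ v ⟨hv, hv'⟩ huv
        have := lip_dist hf (u := s + u) (v := s + v) ⟨by linarith, by linarith⟩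
          ⟨by linarith, by linarith⟩
        rw [abs_sub_comm, abs_of_nonneg (by linarith)] at this
        linarith
      h0 := by simp
      h1 := by simp }
  apply csInf_le (qh_bdd hpos _ _)
  refine ⟨c, ?_⟩
  change _ = ∫ u in (0:ℝ)..(t - s), 1 / dB (f (s + u))
  rw [intervalIntegral.integral_comp_add_left (fun u => 1 / dB (f u)) s]
  simp

theorem qh_nonneg {D : Type*} [MetricSpace D] (hpos : ∀ x : D, 0 < dB x) (x y : D) :
    0 ≤ qhDist x y :=
  Real.sInf_nonneg (by rintro r ⟨c, rfl⟩; exact qhLen_nonneg hpos c)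

theorem qh_self {D : Type*} [MetricSpace D] (hpos : ∀ x : D, 0 < dB x) (x : D) :
    qhDist x x = 0 := by
  apply le_antisymm _ (qh_nonneg hpos x x)
  have := qh_le_int hpos (f := fun _ => x) (le_refl (0:ℝ)) (lip_of_dist (by simp))
  simpa using this

theorem le_qh {D : Type*} [MetricSpace D] (hr : RectConnected D) {x y : D} {m : ℝ}
    (h : ∀ c : Curve D x y, m ≤ c.qhLen) : m ≤ qhDist x y := by
  apply le_csInf
  · obtain ⟨c⟩ := hr x y
    exact ⟨_, c, rfl⟩
  · rintro r ⟨c, rfl⟩; exact h c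

theorem rev_lip {D : Type*} [MetricSpace D] {f : ℝ → D} {L : ℝ}
    (hf : LipschitzOnWith 1 f (Set.Icc 0 L)) :
    LipschitzOnWith 1 (fun u => f (L - u)) (Set.Icc 0 L) := by
  apply lip_of_dist
  rintro u ⟨hu, hu'⟩ v ⟨hv, hv'⟩ huv
  have := lip_dist hf (u := L - u) (v := L - v) ⟨by linarith, by linarith⟩
    ⟨by linarith, by linarith⟩
  rw [abs_of_nonneg (by linarith)] at this
  linarith

theorem qh_symm_le {D : Type*} [MetricSpace D] (hpos : ∀ x : D, 0 < dB x)
    (hr : RectConnected D) (x y : D) : qhDist x y ≤ qhDist y x := by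
  apply le_qh hr
  intro c
  have := qh_le_int hpos c.hL (rev_lip c.lip)
  rw [intervalIntegral.integral_comp_sub_left (fun u => 1 / dB (c.γ u)) c.L] at this
  simpa [c.h0, c.h1, Curve.qhLen, Curve.qhLenOn] using this

theorem qh_symm {D : Type*} [MetricSpace D] (hpos : ∀ x : D, 0 < dB x)
    (hr : RectConnected D) (x y : D) : qhDist x y = qhDist y x :=
  le_antisymm (qh_symm_le hpos hr x y) (qh_symm_le hpos hr y x)

theorem qh_tri_aux {D : Type*} [MetricSpace D] (hpos : ∀ x : D, 0 < dB x) {x y z : D}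
    (c : Curve D x y) (e : Curve D y z) : qhDist x z ≤ c.qhLen + e.qhLen := by
  have hc := c.hL
  have he := e.hL
  let f : ℝ → D := fun u => if u ≤ c.L then c.γ u else e.γ (u - c.L)
  have f1 : ∀ u, u ≤ c.L → f u = c.γ u := fun u hu => if_pos hu
  have f2 : ∀ u, c.L ≤ u → f u = e.γ (u - c.L) := by
    intro u hu
    rcases hu.eq_or_lt with h | h
    · rw [f1 u h.ge, ← h, sub_self, c.h1, e.h0]
    · exact if_neg (not_le.2 h)
  have g1 : ∀ u v, 0 ≤ u → u ≤ v → v ≤ c.L → dist (f u) (f v) ≤ v - u := by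
    intro u v hu huv hv
    rw [f1 u (by linarith), f1 v hv]
    have := lip_dist c.lip (u := u) (v := v) ⟨hu, by linarith⟩ ⟨by linarith, hv⟩
    rwa [abs_sub_comm, abs_of_nonneg (by linarith)] at this
  have g2 : ∀ u v, c.L ≤ u → u ≤ v → v ≤ c.L + e.L → dist (f u) (f v) ≤ v - u := by
    intro u v hu huv hv
    rw [f2 u hu, f2 v (by linarith)]
    have := lip_dist e.lip (u := u - c.L) (v := v - c.L) ⟨by linarith, by linarith⟩
      ⟨by linarith, by linarith⟩
    rw [abs_sub_comm, abs_of_nonneg (by linarith)] at this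
    linarith
  have hf : LipschitzOnWith 1 f (Set.Icc 0 (c.L + e.L)) := by
    apply lip_of_dist
    rintro u ⟨hu, hu'⟩ v ⟨hv, hv'⟩ huv
    rcases le_total v c.L with h | h
    · exact g1 u v hu huv h
    rcases le_total u c.L with h' | h'
    · have a1 := g1 u c.L hu h' le_rfl
      have a2 := g2 c.L v le_rfl h hv'
      linarith [dist_triangle (f u) (f c.L) (f v)]
    · exact g2 u v h' huv hv'
  have key := qh_le_int hpos (by linarith : (0:ℝ) ≤ c.L + e.L) hf
  have e1 : f 0 = x := by rw [f1 0 hc, c.h0]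
  have e2 : f (c.L + e.L) = z := by rw [f2 _ (by linarith)]; simp [e.h1]
  rw [e1, e2] at key
  refine key.trans (le_of_eq ?_)
  rw [← intervalIntegral.integral_add_adjacent_intervals (b := c.L)
    (inv_dB_int hpos hc (hf.mono (Set.Icc_subset_Icc le_rfl (by linarith))))
    (inv_dB_int hpos (by linarith) (hf.mono (Set.Icc_subset_Icc hc le_rfl)))]
  congr 1
  · apply intervalIntegral.integral_congr
    intro u hu
    rw [Set.uIcc_of_le hc] at hu
    simp only [f1 u hu.2]
  · rw [intervalIntegral.integral_congr (g := fun u => 1 / dB (e.γ (u - c.L)))]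
    · rw [intervalIntegral.integral_comp_sub_right (fun u => 1 / dB (e.γ u)) c.L]
      simp [Curve.qhLen, Curve.qhLenOn]
    · intro u hu
      rw [Set.uIcc_of_le (by linarith)] at hu
      simp only [f2 u hu.1]

theorem qh_tri {D : Type*} [MetricSpace D] (hpos : ∀ x : D, 0 < dB x)
    (hr : RectConnected D) (x y z : D) : qhDist x z ≤ qhDist x y + qhDist y z := by
  have : qhDist x z - qhDist y z ≤ qhDist x y := by
    apply le_qh hr
    intro c
    have : qhDist x z - c.qhLen ≤ qhDist y z := by
      apply le_qh hr
      intro e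
      linarith [qh_tri_aux hpos c e]
    linarith
  linarith

theorem log_le_qh {D : Type*} [MetricSpace D] (hpos : ∀ x : D, 0 < dB x)
    (hr : RectConnected D) (x y : D) : Real.log (dB y) - Real.log (dB x) ≤ qhDist x y := by
  apply le_qh hr
  intro c
  have hc := c.hL
  have hx := hpos x
  have h0 : ∀ u ∈ Set.Icc 0 c.L, dB (c.γ u) ≤ u + dB x := by
    intro u hu
    have h1 := dB_le (c.γ u) (c.γ 0)
    have h2 := lip_dist c.lip hu ⟨le_rfl, hc⟩
    rw [sub_zero, abs_of_nonneg hu.1] at h2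
    rw [c.h0] at h1 h2
    linarith
  have h3 : ∫ u in (0:ℝ)..c.L, (u + dB x)⁻¹ = Real.log ((c.L + dB x) / dB x) := by
    rw [intervalIntegral.integral_comp_add_right (fun u => u⁻¹) (dB x)]
    rw [zero_add, integral_inv_of_pos hx (by linarith)]
  have h4 : ∫ u in (0:ℝ)..c.L, (u + dB x)⁻¹ ≤ c.qhLen := by
    apply intervalIntegral.integral_mono_on hc _ (inv_dB_int hpos hc c.lip)
    · intro u hu
      rw [one_div]
      exact inv_anti₀ (hpos _) (h0 u hu)
    · apply ContinuousOn.intervalIntegrable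
      rw [Set.uIcc_of_le hc]
      apply ContinuousOn.inv₀ (by fun_prop)
      intro u hu
      have := hu.1
      positivity
  have h5 := h0 c.L ⟨hc, le_rfl⟩
  rw [c.h1] at h5
  rw [h3, Real.log_div (by positivity) hx.ne'] at h4
  have := Real.log_le_log (hpos y) h5
  linarith

theorem half_log {D : Type*} [MetricSpace D] (hpos : ∀ x : D, 0 < dB x) {a m : ℝ} {f : ℝ → D}
    (hf : LipschitzOnWith 1 f (Set.Icc 0 m)) (hcone : ∀ u ∈ Set.Icc 0 m, u ≤ a * dB (f u))
    {s t : ℝ} (hs : 0 < s) (hst : s ≤ t) (ht : t ≤ m) :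
    qhDist (f s) (f t) ≤ a * (Real.log t - Real.log s) := by
  have hf' := hf.mono (Set.Icc_subset_Icc hs.le ht)
  refine (qh_le_int hpos hst hf').trans ?_
  have h1 : ∫ u in s..t, 1 / dB (f u) ≤ ∫ u in s..t, a * u⁻¹ := by
    apply intervalIntegral.integral_mono_on hst (inv_dB_int hpos hst hf')
    · apply ContinuousOn.intervalIntegrable
      rw [Set.uIcc_of_le hst]
      apply ContinuousOn.mul continuousOn_const
      apply ContinuousOn.inv₀ continuousOn_id
      intro u hu
      exact (hs.trans_le hu.1).ne'
    · intro u hu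
      have hu0 : 0 < u := hs.trans_le hu.1
      have := hcone u ⟨hu0.le, hu.2.trans ht⟩
      rw [div_le_iff₀ (hpos _), mul_assoc, mul_comm u⁻¹, ← mul_assoc, ← div_eq_mul_inv,
        le_div_iff₀ hu0]
      linarith
  refine h1.trans (le_of_eq ?_)
  rw [intervalIntegral.integral_const_mul, integral_inv_of_pos hs (hs.trans_le hst),
    Real.log_div (hs.trans_le hst).ne' hs.ne']

theorem half_start {D : Type*} [MetricSpace D] (hpos : ∀ x : D, 0 < dB x) {a m : ℝ} {f : ℝ → D}
    (ha : 0 ≤ a)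
    (hf : LipschitzOnWith 1 f (Set.Icc 0 m)) (hcone : ∀ u ∈ Set.Icc 0 m, u ≤ a * dB (f u))
    {t : ℝ} (ht0 : 0 ≤ t) (ht : t ≤ m) (htr : t ≤ dB (f 0)) :
    qhDist (f 0) (f t) ≤ 1 + a := by
  have hf' := hf.mono (Set.Icc_subset_Icc le_rfl ht)
  have hr := hpos (f 0)
  refine (qh_le_int hpos ht0 hf').trans ?_
  have h1 : ∫ u in (0:ℝ)..t, 1 / dB (f u) ≤ ∫ u in (0:ℝ)..t, (1 + a) / dB (f 0) := by
    apply intervalIntegral.integral_mono_on ht0 (inv_dB_int hpos ht0 hf')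
    · exact intervalIntegrable_const
    · intro u hu
      have h1 := hcone u ⟨hu.1, hu.2.trans ht⟩
      have h2 := dB_le (f 0) (f u)
      have h3 := lip_dist hf' (u := 0) (v := u) ⟨le_rfl, ht0⟩ hu
      rw [zero_sub, abs_neg, abs_of_nonneg hu.1] at h3
      rw [div_le_div_iff₀ (hpos _) hr]
      linarith
  refine h1.trans ?_
  rw [intervalIntegral.integral_const, sub_zero, smul_eq_mul, mul_div_assoc', div_le_iff₀ hr]
  nlinarith

theorem half_upper {D : Type*} [MetricSpace D] {m : ℝ} {f : ℝ → D}
    (hf : LipschitzOnWith 1 f (Set.Icc 0 m)) {t : ℝ} (ht0 : 0 ≤ t) (ht : t ≤ m)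
    (htr : dB (f 0) ≤ t) : dB (f t) ≤ 2 * t := by
  have h2 := dB_le (f t) (f 0)
  have h3 := lip_dist hf (u := t) (v := 0) ⟨ht0, ht⟩ ⟨le_rfl, ht0.trans ht⟩
  rw [sub_zero, abs_of_nonneg ht0] at h3
  linarith

theorem half_growth {D : Type*} [MetricSpace D] (hpos : ∀ x : D, 0 < dB x) {a m : ℝ} {f : ℝ → D}
    (ha : 1 ≤ a)
    (hf : LipschitzOnWith 1 f (Set.Icc 0 m)) (hcone : ∀ u ∈ Set.Icc 0 m, u ≤ a * dB (f u))
    {s t : ℝ} (hs0 : 0 ≤ s) (hs : min (dB (f 0)) t ≤ s) (hst : s ≤ t) (ht : t ≤ m) :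
    qhDist (f s) (f t) ≤
      a * Real.log (2 * a) + a * (Real.log (dB (f t)) - Real.log (dB (f s))) := by
  have hl : 0 ≤ Real.log (2 * a) := Real.log_nonneg (by linarith)
  rcases hst.eq_or_lt with h | h
  · subst h
    rw [qh_self hpos]
    simp; positivity
  have hrs : dB (f 0) ≤ s := by
    rcases min_le_iff.1 hs with h' | h'
    · exact h'
    · linarith
  have hs1 : 0 < s := (hpos _).trans_le hrs
  refine (half_log hpos hf hcone hs1 hst ht).trans ?_
  rw [← mul_add]
  apply mul_le_mul_of_nonneg_left _ (by linarith)
  have h1 := Real.log_le_log (hs1.trans h) (hcone t ⟨by linarith, ht⟩)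
  have h2 := Real.log_le_log (hpos _) (half_upper hf hs0 (hst.trans ht) hrs)
  rw [Real.log_mul (by linarith) (hpos _).ne'] at h1
  rw [Real.log_mul (by norm_num) hs1.ne'] at h2
  rw [Real.log_mul (by norm_num) (by linarith)]
  linarith

set_option maxHeartbeats 1000000 in
theorem half_morse (a δ B : ℝ) (ha : 1 ≤ a) (hδ : 0 ≤ δ) : ∃ C : ℝ,
    ∀ (D : Type) [MetricSpace D], (∀ x : D, 0 < dB x) → RectConnected D → QHHyperbolic D δ →
    ∀ (f : ℝ → D) (m : ℝ), LipschitzOnWith 1 f (Set.Icc 0 m) →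
      (∀ u ∈ Set.Icc 0 m, u ≤ a * dB (f u)) →
      ∀ (w : D) (t : ℝ), t ∈ Set.Icc 0 m → gromovProd (f 0) (f t) w ≤ B →
      ∃ s, 0 ≤ s ∧ min (dB (f 0)) t ≤ s ∧ s ≤ t ∧ qhDist (f s) w ≤ C := by
  have hlog2 : 0 < Real.log 2 := Real.log_pos (by norm_num)
  have hlog21 : Real.log 2 ≤ 1 := by
    have := Real.log_le_sub_one_of_pos (x := 2) (by norm_num)
    linarith
  set ε : ℝ := Real.log 2 / (2 * (δ + 1)) with hεdef
  have hε : 0 < ε := by positivity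
  have hε2 : 2 * ε * δ ≤ Real.log 2 := by
    have : 2 * ε * (δ + 1) = Real.log 2 := by rw [hεdef]; field_simp
    nlinarith
  obtain ⟨S, hS0, hS⟩ := exp_sum_bound (ε * (Real.log 2 / 2)) (by positivity)
  set M := Real.log (2 * a) with hM
  have hM0 : 0 ≤ M := Real.log_nonneg (by linarith)
  set E : ℝ := M / 2 + a + 1 / 2 with hE
  set B' : ℝ := B + (1 + a) with hB'
  set R : ℝ := max B' (2 * (E + B' + Real.log (2 * S + 1) / ε)) with hR
  refine ⟨R, ?_⟩
  intro D _ hpos hr hyp f m hf hcone w t ht hG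
  by_contra hcon
  push Not at hcon
  have hr0 := hpos (f 0)
  set r := dB (f 0) with hrdef
  have tri := qh_tri hpos hr
  have sym := qh_symm hpos hr
  -- the chain
  let τ : ℕ → ℝ := fun j => min (r * 2 ^ j) t
  have τ0 : τ 0 = min r t := by simp [τ]
  have τle : ∀ j, τ j ≤ t := fun j => min_le_right _ _
  have τge : ∀ j, min r t ≤ τ j := by
    intro j
    apply min_le_min_right
    have : (1:ℝ) ≤ 2 ^ j := one_le_pow₀ (by norm_num)
    nlinarith
  have τnn : ∀ j, 0 ≤ τ j := fun j => (le_min hr0.le ht.1).trans (τge j)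
  have far : ∀ j, R < qhDist (f (τ j)) w := fun j => hcon _ (τnn j) (τge j) (τle j)
  -- the first step
  have hG0 : gromovProd (f (τ 0)) (f t) w ≤ B' := by
    have h1 : qhDist (f 0) (f (τ 0)) ≤ 1 + a :=
      half_start hpos (by linarith) hf hcone (τnn 0) ((τle 0).trans ht.2)
        (by rw [τ0]; exact min_le_left _ _)
    have h2 := tri (f (τ 0)) (f 0) w
    have h3 := tri (f 0) (f (τ 0)) (f t)
    have h4 := sym (f 0) (f (τ 0))
    unfold gromovProd at hG ⊢
    linarith
  have hex : ∃ n : ℕ, t ≤ r * 2 ^ n := by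
    obtain ⟨n, hn⟩ := pow_unbounded_of_one_lt (t / r) (by norm_num : (1:ℝ) < 2)
    refine ⟨n, ?_⟩
    rw [div_lt_iff₀ hr0] at hn
    linarith
  classical
  let n := Nat.find hex
  have hn : t ≤ r * 2 ^ n := Nat.find_spec hex
  have hlt : ∀ j, j < n → r * 2 ^ j < t := fun j hj => not_le.1 (Nat.find_min hex hj)
  have τn : τ n = t := min_eq_right hn
  have hne : f (τ 0) ≠ f (τ n) := by
    intro h
    have := far 0
    rw [τn] at h
    unfold gromovProd at hG0
    rw [← h, qh_self hpos] at hG0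
    linarith [le_max_left B' (2 * (E + B' + Real.log (2 * S + 1) / ε))]
  have fr := frink_chain (fun x y => gromovProd x y w)
    (by intro x y; simp only [gromovProd]; rw [sym x y]; ring) δ ε hδ hε hε2
    (fun x y z => hyp x y z w) (fun j => f (τ j)) n hne
  simp only [τn] at fr
  set θ : ℝ := (Real.log (dB w) - Real.log r) / Real.log 2 with hθ
  have hterm : ∀ j ∈ Finset.range n,
      Real.exp (-ε * gromovProd (f (τ j)) (f (τ (j + 1))) w) ≤
      Real.exp (-ε * (R / 2 - E)) *
        Real.exp (-(ε * (Real.log 2 / 2)) * |(j : ℝ) - (⌊θ⌋ : ℤ)|) := by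
    intro j hj
    rw [Finset.mem_range] at hj
    have hτj : τ j = r * 2 ^ j := min_eq_left (hlt j hj).le
    have hp2 : (0:ℝ) < 2 ^ j := by positivity
    have hτpos : 0 < τ j := by rw [hτj]; positivity
    have hrτ : r ≤ τ j := by
      rw [hτj]
      have : (1:ℝ) ≤ 2 ^ j := one_le_pow₀ (by norm_num)
      nlinarith
    have hτm : τ j ≤ m := (τle j).trans ht.2
    have hτs : τ j ≤ τ (j + 1) := by
      apply min_le_min_right
      rw [pow_succ]; nlinarith
    have hτs2 : τ (j + 1) ≤ 2 * τ j := by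
      rw [hτj]
      refine (min_le_left _ _).trans (le_of_eq ?_)
      rw [pow_succ]; ring
    have hstep : qhDist (f (τ j)) (f (τ (j + 1))) ≤ a := by
      refine (half_log hpos hf hcone hτpos hτs ((τle _).trans ht.2)).trans ?_
      have := Real.log_le_log (hτpos.trans_le hτs) hτs2
      rw [Real.log_mul (by norm_num) hτpos.ne'] at this
      nlinarith
    have hlogτ : Real.log (τ j) = Real.log r + j * Real.log 2 := by
      rw [hτj, Real.log_mul hr0.ne' hp2.ne', Real.log_pow]
    have up := Real.log_le_log (hpos _) (half_upper hf hτpos.le hτm hrτ)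
    have lo := Real.log_le_log hτpos (hcone (τ j) ⟨hτpos.le, hτm⟩)
    rw [Real.log_mul (by norm_num) hτpos.ne'] at up
    rw [Real.log_mul (by linarith) (hpos _).ne'] at lo
    have hMeq : M = Real.log 2 + Real.log a := Real.log_mul (by norm_num) (by linarith)
    have hla : 0 ≤ Real.log a := Real.log_nonneg ha
    have k1 := log_le_qh hpos hr (f (τ j)) w
    have k2 := log_le_qh hpos hr w (f (τ j))
    rw [sym w] at k2
    have hθ2 : θ * Real.log 2 = Real.log (dB w) - Real.log r := by
      rw [hθ]; field_simp
    have hfl1 := Int.floor_le θ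
    have hfl2 := Int.lt_floor_add_one θ
    have k3 : Real.log 2 * (|(j : ℝ) - (⌊θ⌋ : ℤ)| - 1) - M ≤ qhDist (f (τ j)) w := by
      rcases abs_cases ((j : ℝ) - (⌊θ⌋ : ℤ)) with ⟨h, _⟩ | ⟨h, _⟩
      · rw [h]
        have := mul_le_mul_of_nonneg_left hfl2.le hlog2.le
        linarith
      · rw [h]
        have := mul_le_mul_of_nonneg_left hfl1 hlog2.le
        linarith
    have k4 := tri (f (τ j)) (f (τ (j + 1))) w
    have k5 := far j
    have k6 : R / 2 - E + Real.log 2 / 2 * |(j : ℝ) - (⌊θ⌋ : ℤ)| ≤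
        gromovProd (f (τ j)) (f (τ (j + 1))) w := by
      unfold gromovProd
      rw [hE]
      linarith
    rw [← Real.exp_add]
    apply Real.exp_le_exp.2
    have k7 := mul_le_mul_of_nonneg_left k6 hε.le
    linarith
  have hsum := Finset.sum_le_sum hterm
  rw [← Finset.mul_sum] at hsum
  have hfin : Real.exp (-ε * B') ≤ 2 * (Real.exp (-ε * (R / 2 - E)) * S) := by
    calc Real.exp (-ε * B') ≤ Real.exp (-ε * gromovProd (f (τ 0)) (f t) w) := by
          apply Real.exp_le_exp.2
          have := mul_le_mul_of_nonneg_left hG0 hε.le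
          linarith
      _ ≤ _ := fr
      _ ≤ _ := by
          gcongr
          exact hsum.trans (mul_le_mul_of_nonneg_left (hS _ _) (Real.exp_pos _).le)
  have hRge : ε * B' + Real.log (2 * S + 1) ≤ ε * (R / 2 - E) := by
    have h1 := le_max_right B' (2 * (E + B' + Real.log (2 * S + 1) / ε))
    rw [← hR] at h1
    have h2 : B' + Real.log (2 * S + 1) / ε ≤ R / 2 - E := by linarith
    have h3 := mul_le_mul_of_nonneg_left h2 hε.le
    have h4 : ε * (B' + Real.log (2 * S + 1) / ε) = ε * B' + Real.log (2 * S + 1) := by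
      field_simp
    linarith
  have hexp : Real.exp (-ε * (R / 2 - E)) * (2 * S + 1) ≤ Real.exp (-ε * B') := by
    have : (2 * S + 1) = Real.exp (Real.log (2 * S + 1)) := (Real.exp_log (by linarith)).symm
    rw [this, ← Real.exp_add]
    apply Real.exp_le_exp.2
    linarith
  have := Real.exp_pos (-ε * (R / 2 - E))
  nlinarith

theorem geo_half (a δ : ℝ) (ha : 1 ≤ a) (hδ : 0 ≤ δ) : ∃ b : ℝ,
    ∀ (D : Type) [MetricSpace D], (∀ x : D, 0 < dB x) → RectConnected D → QHHyperbolic D δ →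
    ∀ (f : ℝ → D) (m : ℝ), 0 ≤ m → LipschitzOnWith 1 f (Set.Icc 0 m) →
      (∀ u ∈ Set.Icc 0 m, u ≤ a * dB (f u)) →
      ∀ (g : ℝ → D) (l : ℝ), LipschitzOnWith 1 g (Set.Icc 0 l) → g 0 = f 0 →
      (∀ s t : ℝ, s ∈ Set.Icc 0 l → t ∈ Set.Icc 0 l → s ≤ t →
        ∫ u in s..t, 1 / dB (g u) = qhDist (g s) (g t)) →
      ∀ s ∈ Set.Icc 0 l, gromovProd (f 0) (f m) (g s) ≤ δ → s ≤ b * dB (g s) := by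
  obtain ⟨C₀, hC₀⟩ := half_morse a δ δ ha hδ
  obtain ⟨C₁, hC₁⟩ := half_morse a δ C₀ ha hδ
  set N : ℝ := C₁ + C₀ + a * Real.log (2 * a) + a * C₀ + a * C₁ with hN
  refine ⟨a * Real.exp (N / a), ?_⟩
  intro D _ hpos hr hyp f m hm hf hcone g l hg hg0 hgeo s hs hG
  have tri := qh_tri hpos hr
  have sym := qh_symm hpos hr
  obtain ⟨t, ht0, _, htm, hkt⟩ := hC₀ D hpos hr hyp f m hf hcone (g s) m ⟨hm, le_rfl⟩ hG
  set z := g s with hz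
  -- pointwise estimate
  have main : ∀ u ∈ Set.Icc 0 s,
      qhDist (g u) z ≤ N + a * (Real.log (dB z) - Real.log (dB (g u))) := by
    intro u hu
    have hul : u ∈ Set.Icc 0 l := ⟨hu.1, hu.2.trans hs.2⟩
    have h0l : (0:ℝ) ∈ Set.Icc 0 l := ⟨le_rfl, hs.1.trans hs.2⟩
    set w := g u with hw
    have hadd : qhDist (f 0) w + qhDist w z = qhDist (f 0) z := by
      rw [← hg0, hw, hz, ← hgeo 0 u h0l hul hu.1, ← hgeo u s hul hs hu.2,
        ← hgeo 0 s h0l hs hs.1]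
      exact intervalIntegral.integral_add_adjacent_intervals
        (inv_dB_int hpos hu.1 (hg.mono (Set.Icc_subset_Icc le_rfl hul.2)))
        (inv_dB_int hpos hu.2 (hg.mono (Set.Icc_subset_Icc hu.1 hs.2)))
    have hG2 : gromovProd (f 0) (f t) w ≤ C₀ := by
      unfold gromovProd
      have h1 := tri (f t) z w
      have h2 := tri (f 0) (f t) z
      have h3 := sym z w
      linarith
    obtain ⟨t', ht'0, ht'1, ht't, hkt'⟩ := hC₁ D hpos hr hyp f m hf hcone w t ⟨ht0, htm⟩ hG2
    have h1 := half_growth hpos ha hf hcone ht'0 ht'1 ht't htm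
    have h2 := tri w (f t') z
    have h3 := tri (f t') (f t) z
    have h4 := sym w (f t')
    have h5 := log_le_qh hpos hr z (f t)
    have h6 := log_le_qh hpos hr (f t') w
    rw [sym z] at h5
    have h7 : a * (Real.log (dB (f t)) - Real.log (dB (f t'))) ≤
        a * (C₀ + C₁ + (Real.log (dB z) - Real.log (dB w))) :=
      mul_le_mul_of_nonneg_left (by linarith) (by linarith)
    rw [hN]
    linarith
  -- integrate
  let h : ℝ → ℝ := Set.IccExtend hs.1 (fun u : Set.Icc 0 s => 1 / dB (g u))
  have hcontOn := inv_dB_contOn hpos (hg.mono (Set.Icc_subset_Icc le_rfl hs.2))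
  have hcont : Continuous h := (continuousOn_iff_continuous_domRestrict.1 hcontOn).Icc_extend'
  have heq : ∀ u ∈ Set.Icc 0 s, h u = 1 / dB (g u) := by
    intro u hu
    exact Set.IccExtend_of_mem hs.1 _ hu
  let κ : ℝ → ℝ := fun u => ∫ v in u..s, h v
  have hκ : ∀ u ∈ Set.Icc 0 s, κ u = qhDist (g u) z := by
    intro u hu
    rw [hz, ← hgeo u s ⟨hu.1, hu.2.trans hs.2⟩ hs hu.2]
    apply intervalIntegral.integral_congr
    intro v hv
    rw [Set.uIcc_of_le hu.2] at hv
    exact heq v ⟨hu.1.trans hv.1, hv.2⟩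
  have hκd : ∀ u, HasDerivAt κ (-h u) u := fun u =>
    intervalIntegral.integral_hasDerivAt_left (hcont.intervalIntegrable _ _)
      (hcont.stronglyMeasurableAtFilter _ _) hcont.continuousAt
  set P : ℝ := a * Real.exp (N / a) * dB z with hP
  have hz0 := hpos z
  have ha0 : 0 < a := by linarith
  have hPpos : 0 < P := by positivity
  let F : ℝ → ℝ := fun u => P * Real.exp (-κ u / a) - u
  have hFd : ∀ u, HasDerivAt F (P * (Real.exp (-κ u / a) * (h u / a)) - 1) u := by
    intro u
    have h1 : HasDerivAt (fun u => -κ u / a) (h u / a) u := by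
      simpa using ((hκd u).neg.div_const a)
    exact (h1.exp.const_mul P).sub (hasDerivAt_id u)
  have hmono : MonotoneOn F (Set.Icc 0 s) := by
    apply monotoneOn_of_deriv_nonneg (convex_Icc 0 s)
    · exact fun u _ => (hFd u).continuousAt.continuousWithinAt
    · exact fun u _ => (hFd u).differentiableAt.differentiableWithinAt
    · intro u hu
      rw [(hFd u).deriv]
      have hu' : u ∈ Set.Icc 0 s := interior_subset hu
      have hm := main u hu'
      rw [← hκ u hu'] at hm
      have hg0 := hpos (g u)
      have h1 : dB (g u) ≤ Real.exp (N / a) * dB z * Real.exp (-κ u / a) := by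
        have h2 : Real.log (dB (g u)) ≤ N / a + Real.log (dB z) + -κ u / a := by
          have : κ u / a ≤ (N + a * (Real.log (dB z) - Real.log (dB (g u)))) / a :=
            div_le_div_of_nonneg_right hm ha0.le
          rw [add_div, mul_div_cancel_left₀ _ ha0.ne'] at this
          rw [neg_div]
          linarith
        have h3 := Real.exp_le_exp.2 h2
        rwa [Real.exp_add, Real.exp_add, Real.exp_log hg0, Real.exp_log hz0] at h3
      rw [heq u hu', hP]
      have h4 : a * Real.exp (N / a) * dB z * (Real.exp (-κ u / a) * (1 / dB (g u) / a)) =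
          (Real.exp (N / a) * dB z * Real.exp (-κ u / a)) / dB (g u) := by
        field_simp
      rw [h4, sub_nonneg, le_div_iff₀ hg0, one_mul]
      exact h1
  have hF := hmono ⟨le_rfl, hs.1⟩ ⟨hs.1, le_rfl⟩ hs.1
  have hκs : κ s = 0 := intervalIntegral.integral_same
  simp only [F, hκs] at hF
  have := Real.exp_pos (-κ 0 / a)
  simp only [neg_zero, zero_div, Real.exp_zero] at hF
  nlinarith

/-- Theorem 1.5: in a locally compact, rectifiably connected,
noncomplete `a`-John space whose quasihyperbolization is `K`-roughly starlike
and `δ`-hyperbolic, every quasihyperbolic geodesic is a `b`-cone arc with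
`b = b(a, δ, K)`. -/
theorem stmt9 :
    ∀ a δ K : ℝ, 1 ≤ a → 0 ≤ δ → 0 < K → ∃ b : ℝ,
      ∀ (D : Type) [MetricSpace D], LocallyCompactSpace D → RectConnected D →
        ¬ CompleteSpace D → IsJohn D a → QHHyperbolic D δ →
        (∃ w : D, RoughlyStarlike D K w) →
        ∀ (x y : D) (γ : Curve D x y), γ.IsQHGeodesic → γ.IsConeArc b := by
  intro a δ K ha hδ _
  obtain ⟨b, hb⟩ := geo_half a δ ha hδ
  refine ⟨b, ?_⟩
  intro D _ hlc hr hnc hJ hyp _ x y γ hγ s hs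
  have hpos : ∀ x : D, 0 < dB x := fun x => dB_pos' hnc x
  have sym := qh_symm hpos hr
  obtain ⟨α, hα⟩ := hJ x y
  have hαL := α.hL
  have hγL := γ.hL
  have hzero : gromovProd x y (γ.γ s) = 0 := by
    have h0 : (0:ℝ) ∈ Set.Icc 0 γ.L := ⟨le_rfl, hγL⟩
    have h1 : γ.L ∈ Set.Icc 0 γ.L := ⟨hγL, le_rfl⟩
    have e1 := hγ 0 s h0 hs hs.1
    have e2 := hγ s γ.L hs h1 hs.2
    have e3 := hγ 0 γ.L h0 h1 hγL
    have e4 : γ.qhLenOn 0 s + γ.qhLenOn s γ.L = γ.qhLenOn 0 γ.L :=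
      intervalIntegral.integral_add_adjacent_intervals
        (inv_dB_int hpos hs.1 (γ.lip.mono (Set.Icc_subset_Icc le_rfl hs.2)))
        (inv_dB_int hpos hs.2 (γ.lip.mono (Set.Icc_subset_Icc hs.1 le_rfl)))
    rw [γ.h0] at e1 e3
    rw [γ.h1] at e2 e3
    have e5 := sym y (γ.γ s)
    unfold gromovProd
    linarith
  have h4 := hyp x (α.γ (α.L / 2)) y (γ.γ s)
  rw [hzero] at h4
  have h5 : min (gromovProd x (α.γ (α.L / 2)) (γ.γ s))
      (gromovProd (α.γ (α.L / 2)) y (γ.γ s)) ≤ δ := by linarith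
  rcases min_le_iff.1 h5 with h | h
  · refine (min_le_left _ _).trans ?_
    refine hb D hpos hr hyp α.γ (α.L / 2) (by linarith)
      (α.lip.mono (Set.Icc_subset_Icc le_rfl (by linarith))) ?_ γ.γ γ.L γ.lip
      (by rw [γ.h0, α.h0]) hγ s hs (by rw [α.h0]; exact h)
    intro u hu
    have := hα u ⟨hu.1, by linarith [hu.2]⟩
    rwa [min_eq_left (by linarith [hu.2])] at this
  · refine (min_le_right _ _).trans ?_
    have key := hb D hpos hr hyp (fun u => α.γ (α.L - u)) (α.L / 2) (by linarith)
      ((rev_lip α.lip).mono (Set.Icc_subset_Icc le_rfl (by linarith))) ?_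
      (fun u => γ.γ (γ.L - u)) γ.L (rev_lip γ.lip)
      (by simp [γ.h1, α.h1]) ?_ (γ.L - s) ⟨by linarith [hs.2], by linarith [hs.1]⟩ ?_
    · simpa using key
    · intro u hu
      have := hα (α.L - u) ⟨by linarith [hu.2], by linarith [hu.1]⟩
      rwa [min_eq_right (by linarith [hu.2]), sub_sub_cancel] at this
    · intro p q hp hq hpq
      have e := hγ (γ.L - q) (γ.L - p) ⟨by linarith [hq.2], by linarith [hq.1]⟩
        ⟨by linarith [hp.2], by linarith [hp.1]⟩ (by linarith)
      rw [sym] at e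
      rw [← e, Curve.qhLenOn]
      exact intervalIntegral.integral_comp_sub_left (fun u => 1 / dB (γ.γ u)) γ.L
    · have e : α.L - α.L / 2 = α.L / 2 := by ring
      simp only [sub_zero, sub_sub_cancel, e, α.h1]
      have : gromovProd y (α.γ (α.L / 2)) (γ.γ s) = gromovProd (α.γ (α.L / 2)) y (γ.γ s) := by
        simp only [gromovProd]; rw [sym y (α.γ (α.L / 2))]; ring
      rw [this]; exact h
end

section
/- Every quasihyperbolic geodesic in an a-John, δ-hyperbolic proper subdomain D of ℝⁿ is a b-cone arc, with b depending only on a and δ. -/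
open Set Metric

namespace QH

variable {D : Type*} [MetricSpace D]

theorem dB_lip (x y : D) : dB x ≤ dB y + dist x y := by
  unfold dB
  have := Metric.infDist_le_infDist_add_dist
    (s := (Set.range ((↑) : D → UniformSpace.Completion D))ᶜ)
    (x := (x : UniformSpace.Completion D)) (y := (y : UniformSpace.Completion D))
  rwa [UniformSpace.Completion.dist_eq] at this

theorem dB_cont : Continuous (dB : D → ℝ) :=
  (Metric.continuous_infDist_pt _).comp (UniformSpace.Completion.continuous_coe D)

theorem lip_dist {f : ℝ → D} {S : Set ℝ} (hf : LipschitzOnWith 1 f S) {u v : ℝ}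
    (hu : u ∈ S) (hv : v ∈ S) : dist (f u) (f v) ≤ |u - v| := by
  have := hf.dist_le_mul u hu v hv
  simpa [Real.dist_eq] using this

theorem lip_of_dist {f : ℝ → D} {S : Set ℝ}
    (h : ∀ u ∈ S, ∀ v ∈ S, u ≤ v → dist (f u) (f v) ≤ v - u) : LipschitzOnWith 1 f S := by
  apply LipschitzOnWith.of_dist_le_mul
  intro u hu v hv
  rw [Real.dist_eq]
  rcases le_total u v with huv | huv
  · rw [abs_sub_comm, abs_of_nonneg (by linarith)]
    simpa using h u hu v hv huv
  · rw [dist_comm, abs_of_nonneg (by linarith)]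
    simpa using h v hv u hu huv

theorem contOn (hpos : ∀ x : D, 0 < dB x) {f : ℝ → D} {S : Set ℝ}
    (hf : ContinuousOn f S) : ContinuousOn (fun u => 1 / dB (f u)) S := by
  apply ContinuousOn.div continuousOn_const (dB_cont.comp_continuousOn hf)
  intro u _
  exact (hpos _).ne'

theorem intble (hpos : ∀ x : D, 0 < dB x) {f : ℝ → D} {s t : ℝ} (hst : s ≤ t)
    (hf : LipschitzOnWith 1 f (Icc s t)) :
    IntervalIntegrable (fun u => 1 / dB (f u)) MeasureTheory.volume s t := by
  apply ContinuousOn.intervalIntegrable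
  rw [uIcc_of_le hst]
  exact contOn hpos hf.continuousOn

theorem qhLen_nonneg (hpos : ∀ x : D, 0 < dB x) {x y : D} (c : Curve D x y) :
    0 ≤ c.qhLen := by
  unfold Curve.qhLen Curve.qhLenOn
  apply intervalIntegral.integral_nonneg c.hL
  intro u _
  exact (div_pos one_pos (hpos _)).le

theorem qhDist_le_qhLen (hpos : ∀ x : D, 0 < dB x) {x y : D} (c : Curve D x y) :
    qhDist x y ≤ c.qhLen := by
  apply csInf_le
  · refine ⟨0, ?_⟩
    rintro r ⟨c, rfl⟩
    exact qhLen_nonneg hpos c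
  · exact ⟨c, rfl⟩

theorem le_qhDist (hrc : RectConnected D) {x y : D} {b : ℝ}
    (h : ∀ c : Curve D x y, b ≤ c.qhLen) : b ≤ qhDist x y := by
  apply le_csInf
  · obtain ⟨c⟩ := hrc x y
    exact ⟨_, c, rfl⟩
  · rintro r ⟨c, rfl⟩
    exact h c

theorem exists_near (hrc : RectConnected D) (x y : D) {ε : ℝ} (hε : 0 < ε) :
    ∃ c : Curve D x y, c.qhLen < qhDist x y + ε := by
  have hne : {r : ℝ | ∃ c : Curve D x y, r = c.qhLen}.Nonempty := by
    obtain ⟨c⟩ := hrc x y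
    exact ⟨_, c, rfl⟩
  obtain ⟨r, ⟨c, rfl⟩, hr⟩ := exists_lt_of_csInf_lt hne
    (show sInf {r : ℝ | ∃ c : Curve D x y, r = c.qhLen} < qhDist x y + ε by
      unfold qhDist; linarith)
  exact ⟨c, hr⟩

/-- The distance is bounded by the length of any 1-Lipschitz path. -/
theorem qhDist_le_path (hpos : ∀ x : D, 0 < dB x) {f : ℝ → D} {s t : ℝ} (hst : s ≤ t)
    (hf : LipschitzOnWith 1 f (Icc s t)) :
    qhDist (f s) (f t) ≤ ∫ u in s..t, 1 / dB (f u) := by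
  let c : Curve D (f s) (f t) :=
    { L := t - s
      hL := by linarith
      γ := fun u => f (u + s)
      lip := by
        apply lip_of_dist
        intro u hu v hv huv
        have := lip_dist hf (u := u + s) (v := v + s) ⟨by linarith [hu.1], by linarith [hu.2]⟩
          ⟨by linarith [hv.1], by linarith [hv.2]⟩
        rw [abs_sub_comm, abs_of_nonneg (by linarith)] at this
        linarith
      h0 := by simp
      h1 := by simp }
  have h := qhDist_le_qhLen hpos c
  have h2 : c.qhLen = ∫ u in s..t, 1 / dB (f u) := by
    change ∫ u in (0 : ℝ)..(t - s), 1 / dB (f (u + s)) = _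
    rw [intervalIntegral.integral_comp_add_right (fun u => 1 / dB (f u))]
    simp
  linarith

theorem qhDist_symm_le (hpos : ∀ x : D, 0 < dB x) (hrc : RectConnected D) (x y : D) :
    qhDist y x ≤ qhDist x y := by
  apply le_qhDist hrc
  intro c
  let c' : Curve D y x :=
    { L := c.L
      hL := c.hL
      γ := fun u => c.γ (c.L - u)
      lip := by
        apply lip_of_dist
        intro u hu v hv huv
        have := lip_dist c.lip (u := c.L - u) (v := c.L - v)
          ⟨by linarith [hu.2], by linarith [hu.1]⟩
          ⟨by linarith [hv.2], by linarith [hv.1]⟩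
        rw [abs_of_nonneg (by linarith)] at this
        linarith
      h0 := by simp [c.h1]
      h1 := by simp [c.h0] }
  have h := qhDist_le_qhLen hpos c'
  have h2 : c'.qhLen = c.qhLen := by
    change ∫ u in (0 : ℝ)..c.L, 1 / dB (c.γ (c.L - u)) = ∫ u in (0 : ℝ)..c.L, 1 / dB (c.γ u)
    rw [intervalIntegral.integral_comp_sub_left (fun u => 1 / dB (c.γ u))]
    simp
  linarith

theorem qhDist_symm (hpos : ∀ x : D, 0 < dB x) (hrc : RectConnected D) (x y : D) :
    qhDist x y = qhDist y x :=
  le_antisymm (qhDist_symm_le hpos hrc y x) (qhDist_symm_le hpos hrc x y)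

theorem qhLen_concat (hpos : ∀ x : D, 0 < dB x) {x y z : D} (c₁ : Curve D x y)
    (c₂ : Curve D y z) : qhDist x z ≤ c₁.qhLen + c₂.qhLen := by
  have hL₁ := c₁.hL
  have hL₂ := c₂.hL
  let f : ℝ → D := fun u => if u ≤ c₁.L then c₁.γ u else c₂.γ (u - c₁.L)
  have f1 : ∀ u, u ≤ c₁.L → f u = c₁.γ u := fun u hu => if_pos hu
  have f2 : ∀ u, c₁.L ≤ u → f u = c₂.γ (u - c₁.L) := by
    intro u hu
    rcases eq_or_lt_of_le hu with h | h
    · rw [f1 u h.ge, ← h, sub_self, c₂.h0, c₁.h1]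
    · exact if_neg (not_le.2 h)
  have hf : LipschitzOnWith 1 f (Icc 0 (c₁.L + c₂.L)) := by
    have a1 : ∀ u v, 0 ≤ u → u ≤ v → v ≤ c₁.L → dist (f u) (f v) ≤ v - u := by
      intro u v hu huv hv
      rw [f1 u (by linarith), f1 v hv]
      have := lip_dist c₁.lip (u := u) (v := v) ⟨hu, by linarith⟩ ⟨by linarith, hv⟩
      rwa [abs_sub_comm, abs_of_nonneg (by linarith)] at this
    have a2 : ∀ u v, c₁.L ≤ u → u ≤ v → v ≤ c₁.L + c₂.L → dist (f u) (f v) ≤ v - u := by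
      intro u v hu huv hv
      rw [f2 u hu, f2 v (by linarith)]
      have := lip_dist c₂.lip (u := u - c₁.L) (v := v - c₁.L) ⟨by linarith, by linarith⟩
        ⟨by linarith, by linarith⟩
      rw [abs_sub_comm, abs_of_nonneg (by linarith)] at this
      linarith
    apply lip_of_dist
    intro u hu v hv huv
    rcases le_total v c₁.L with h | h
    · exact a1 u v hu.1 huv h
    · rcases le_total u c₁.L with h' | h'
      · have := dist_triangle (f u) (f c₁.L) (f v)
        have b1 := a1 u c₁.L hu.1 h' le_rfl
        have b2 := a2 c₁.L v le_rfl h hv.2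
        linarith
      · exact a2 u v h' huv hv.2
  have h := qhDist_le_path hpos (f := f) (s := 0) (t := c₁.L + c₂.L) (by linarith) hf
  rw [f1 0 hL₁, f2 _ (by linarith), c₁.h0, add_sub_cancel_left, c₂.h1] at h
  have i1 : IntervalIntegrable (fun u => 1 / dB (f u)) MeasureTheory.volume 0 c₁.L :=
    intble hpos hL₁ (hf.mono (Icc_subset_Icc le_rfl (by linarith)))
  have i2 : IntervalIntegrable (fun u => 1 / dB (f u)) MeasureTheory.volume c₁.L (c₁.L + c₂.L) :=
    intble hpos (by linarith) (hf.mono (Icc_subset_Icc hL₁ le_rfl))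
  rw [← intervalIntegral.integral_add_adjacent_intervals i1 i2] at h
  have e1 : ∫ u in (0 : ℝ)..c₁.L, 1 / dB (f u) = c₁.qhLen := by
    unfold Curve.qhLen Curve.qhLenOn
    apply intervalIntegral.integral_congr
    intro u hu
    rw [uIcc_of_le hL₁] at hu
    simp only [f1 u hu.2]
  have e2 : ∫ u in c₁.L..(c₁.L + c₂.L), 1 / dB (f u) = c₂.qhLen := by
    have : ∫ u in c₁.L..(c₁.L + c₂.L), 1 / dB (f u) =
        ∫ u in c₁.L..(c₁.L + c₂.L), 1 / dB (c₂.γ (u - c₁.L)) := by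
      apply intervalIntegral.integral_congr
      intro u hu
      rw [uIcc_of_le (by linarith)] at hu
      simp only [f2 u hu.1]
    rw [this, intervalIntegral.integral_comp_sub_right (fun u => 1 / dB (c₂.γ u))]
    simp [Curve.qhLen, Curve.qhLenOn]
  linarith

theorem qhDist_triangle (hpos : ∀ x : D, 0 < dB x) (hrc : RectConnected D) (x y z : D) :
    qhDist x z ≤ qhDist x y + qhDist y z := by
  apply le_of_forall_pos_le_add
  intro ε hε
  obtain ⟨c₁, h₁⟩ := exists_near hrc x y (half_pos hε)
  obtain ⟨c₂, h₂⟩ := exists_near hrc y z (half_pos hε)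
  have := qhLen_concat hpos c₁ c₂
  linarith

theorem qhDist_nonneg (hpos : ∀ x : D, 0 < dB x) (hrc : RectConnected D) (x y : D) :
    0 ≤ qhDist x y := le_qhDist hrc fun c => qhLen_nonneg hpos c

theorem integral_shift_inv {ρ s t : ℝ} (hs : 0 < s + ρ) (hst : s ≤ t) :
    ∫ u in s..t, 1 / (u + ρ) = Real.log ((t + ρ) / (s + ρ)) := by
  rw [intervalIntegral.integral_comp_add_right (fun u => 1 / u)]
  exact integral_one_div_of_pos hs (by linarith)

theorem shift_intble {ρ s t : ℝ} (hs : 0 < s + ρ) (hst : s ≤ t) :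
    IntervalIntegrable (fun u => 1 / (u + ρ)) MeasureTheory.volume s t := by
  apply ContinuousOn.intervalIntegrable
  rw [uIcc_of_le hst]
  apply ContinuousOn.div continuousOn_const (by fun_prop)
  intro u hu
  have := hu.1
  linarith

theorem log_le_qhDist (hpos : ∀ x : D, 0 < dB x) (hrc : RectConnected D) (x y : D) :
    Real.log (dB y / dB x) ≤ qhDist x y := by
  apply le_qhDist hrc
  intro c
  have hL := c.hL
  have hx := hpos x
  have key : ∀ u ∈ Icc 0 c.L, dB (c.γ u) ≤ u + dB x := by
    intro u hu
    have h1 := dB_lip (c.γ u) x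
    have h2 := lip_dist c.lip (u := u) (v := 0) hu ⟨le_rfl, hL⟩
    rw [c.h0, sub_zero, abs_of_nonneg hu.1] at h2
    linarith
  have h1 : ∫ u in (0 : ℝ)..c.L, 1 / (u + dB x) ≤ c.qhLen := by
    unfold Curve.qhLen Curve.qhLenOn
    apply intervalIntegral.integral_mono_on hL (shift_intble (by linarith) hL)
      (intble hpos hL c.lip)
    intro u hu
    exact one_div_le_one_div_of_le (hpos _) (key u hu)
  rw [integral_shift_inv (by linarith) hL] at h1
  refine le_trans ?_ h1
  have h2 := key c.L ⟨hL, le_rfl⟩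
  rw [c.h1] at h2
  apply Real.log_le_log (div_pos (hpos _) hx)
  rw [zero_add]
  gcongr

/-- One-sided chain estimate. -/
theorem chain (hpos : ∀ x : D, 0 < dB x) (hrc : RectConnected D) {δ : ℝ} (hδ : 0 ≤ δ)
    (hyp : QHHyperbolic D δ) {A B R F f₀ : ℝ} (hA : 0 ≤ A) {P : ℝ → D} {z : D}
    (hlow : ∀ f ∈ Icc 0 F, ∀ g ∈ Icc 0 F, |f - g| - B ≤ qhDist (P f) (P g))
    (hup : ∀ f ∈ Icc 0 F, ∀ g ∈ Icc 0 F, qhDist (P f) (P g) ≤ A * |f - g|)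
    (hR : ∀ f ∈ Icc 0 F, R ≤ qhDist (P f) z) (hf₀ : f₀ ∈ Icc 0 F)
    (hR₀ : qhDist (P f₀) z ≤ R + 1) (n : ℕ) :
    ∀ f g, f₀ ≤ f → f ≤ g → g ≤ F → g - f ≤ (n + 1) * (4 * δ + 1) →
      R / 2 + (f - f₀) / 4 - (A * (4 * δ + 1) + (B + 1) / 4) - δ
        ≤ gromovProd (P f) (P g) z := by
  have step : ∀ f g, f₀ ≤ f → f ≤ g → g ≤ F → g - f ≤ 4 * δ + 1 →
      R / 2 + (f - f₀) / 4 - (A * (4 * δ + 1) + (B + 1) / 4) ≤ gromovProd (P f) (P g) z := by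
    intro f g h0 h1 h2 h3
    have mf : f ∈ Icc 0 F := ⟨by linarith [hf₀.1], by linarith⟩
    have mg : g ∈ Icc 0 F := ⟨by linarith [hf₀.1], by linarith⟩
    have e1 := hlow f mf f₀ hf₀
    have e2 := hup f mf g mg
    rw [abs_of_nonneg (by linarith)] at e1
    rw [abs_sub_comm, abs_of_nonneg (by linarith)] at e2
    have e3 := hR f mf
    have e4 := qhDist_triangle hpos hrc (P f) z (P f₀)
    have e5 := qhDist_symm hpos hrc z (P f₀)
    have e6 := qhDist_triangle hpos hrc (P f) (P g) z
    have e7 : A * (g - f) ≤ A * (4 * δ + 1) := mul_le_mul_of_nonneg_left h3 hA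
    unfold gromovProd
    linarith
  induction n with
  | zero =>
    intro f g h0 h1 h2 h3
    have := step f g h0 h1 h2 (by simpa using h3)
    linarith
  | succ n ih =>
    intro f g h0 h1 h2 h3
    by_cases hh : g - f ≤ 4 * δ + 1
    · have := step f g h0 h1 h2 hh
      linarith
    · have s1 := step f (f + (4 * δ + 1)) h0 (by linarith) (by linarith) (by linarith)
      have s2 := ih (f + (4 * δ + 1)) g (by linarith) (by linarith) h2 (by
        push_cast at h3
        linarith)
      have s3 := hyp (P f) (P (f + (4 * δ + 1))) (P g) z
      refine le_trans ?_ s3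
      rw [le_sub_iff_add_le, le_min_iff]
      constructor <;> linarith

/-- A point coarsely between the ends of a quasigeodesic is close to it. -/
theorem near (hpos : ∀ x : D, 0 < dB x) (hrc : RectConnected D) {δ : ℝ} (hδ : 0 ≤ δ)
    (hyp : QHHyperbolic D δ) {A B F : ℝ} (hA : 0 ≤ A) (hF : 0 ≤ F) {P : ℝ → D} {z : D}
    (hlow : ∀ f ∈ Icc 0 F, ∀ g ∈ Icc 0 F, |f - g| - B ≤ qhDist (P f) (P g))
    (hup : ∀ f ∈ Icc 0 F, ∀ g ∈ Icc 0 F, qhDist (P f) (P g) ≤ A * |f - g|)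
    (hz : gromovProd (P 0) (P F) z ≤ δ) :
    ∃ f ∈ Icc 0 F, qhDist (P f) z ≤ 2 * (A * (4 * δ + 1) + (B + 1) / 4) + 6 * δ + 1 := by
  set S : Set ℝ := (fun f => qhDist (P f) z) '' Icc 0 F with hS
  have hne : S.Nonempty := ⟨_, 0, ⟨le_rfl, hF⟩, rfl⟩
  have hbd : BddBelow S := by
    refine ⟨0, ?_⟩
    rintro _ ⟨f, _, rfl⟩
    exact qhDist_nonneg hpos hrc _ _
  obtain ⟨_, ⟨f₀, hf₀, rfl⟩, hlt⟩ := exists_lt_of_csInf_lt hne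
    (show sInf S < sInf S + 1 by linarith)
  set R := sInf S with hRdef
  have hR : ∀ f ∈ Icc 0 F, R ≤ qhDist (P f) z := fun f hf => csInf_le hbd ⟨f, hf, rfl⟩
  simp only at hlt
  obtain ⟨n, hn⟩ := exists_nat_ge F
  have hnF : F ≤ (n + 1) * (4 * δ + 1) := by nlinarith [(Nat.cast_nonneg n : (0 : ℝ) ≤ n)]
  have r1 := chain hpos hrc hδ hyp hA hlow hup hR hf₀ hlt.le n f₀ F le_rfl hf₀.2 le_rfl
    (by linarith [hf₀.1])
  have mm : ∀ f ∈ Icc 0 F, F - f ∈ Icc 0 F := fun f hf =>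
    ⟨by linarith [hf.2], by linarith [hf.1]⟩
  have r2 := chain hpos hrc hδ hyp (A := A) (B := B) (R := R) (F := F) (f₀ := F - f₀) hA
    (P := fun f => P (F - f)) (z := z)
    (fun f hf g hg => by
      have := hlow _ (mm f hf) _ (mm g hg)
      rwa [show F - f - (F - g) = -(f - g) by ring, abs_neg] at this)
    (fun f hf g hg => by
      have := hup _ (mm f hf) _ (mm g hg)
      rwa [show F - f - (F - g) = -(f - g) by ring, abs_neg] at this)
    (fun f hf => hR _ (mm f hf)) (mm f₀ hf₀) (by simpa using hlt.le) n (F - f₀) F le_rfl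
    (by linarith [hf₀.1]) le_rfl (by linarith [hf₀.2])
  simp only [sub_self, sub_sub_cancel, zero_div, add_zero] at r1 r2
  have r3 := hyp (P 0) (P f₀) (P F) z
  have r4 : gromovProd (P 0) (P f₀) z = gromovProd (P f₀) (P 0) z := by
    unfold gromovProd
    rw [qhDist_symm hpos hrc (P 0) (P f₀)]
    ring
  rw [r4] at r3
  have r5 := le_trans (sub_le_sub_right (le_min r2 r1) δ) r3
  exact ⟨f₀, hf₀, by linarith⟩

/-- The additive constant. -/
noncomputable def HH (a δ : ℝ) : ℝ :=
  2 * ((2 * a + 1) * (4 * δ + 1) + (Real.log (2 * a + 1) + 1) / 4) + 6 * δ + 1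

/-- The cone constant in logarithmic form. -/
noncomputable def CC (a δ : ℝ) : ℝ := (2 * a + 1) * (HH a δ + Real.log (2 * a + 1)) + HH a δ

theorem HH_nonneg {a δ : ℝ} (ha : 1 ≤ a) (hδ : 0 ≤ δ) : 0 ≤ HH a δ := by
  unfold HH
  have : 0 ≤ Real.log (2 * a + 1) := Real.log_nonneg (by linarith)
  positivity

/-- Half of a John arc: points coarsely between its ends satisfy a logarithmic estimate. -/
theorem half (hpos : ∀ x : D, 0 < dB x) (hrc : RectConnected D) {a δ : ℝ} (ha : 1 ≤ a)
    (hδ : 0 ≤ δ) (hyp : QHHyperbolic D δ) {M : ℝ} (hM : 0 ≤ M) {α : ℝ → D}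
    (hα : LipschitzOnWith 1 α (Icc 0 M)) (hc : ∀ s ∈ Icc 0 M, s ≤ a * dB (α s)) {z : D}
    (hz : gromovProd (α 0) (α M) z ≤ δ) :
    qhDist (α 0) z ≤ (2 * a + 1) * Real.log (dB z / dB (α 0)) + CC a δ := by
  set ρ := dB (α 0) with hρ
  have hρ0 : 0 < ρ := hpos _
  set A := 2 * a + 1 with hAdef
  have hA : 0 < A := by linarith
  have hlo : ∀ s ∈ Icc 0 M, s + ρ ≤ A * dB (α s) := by
    intro s hs
    have h1 := hc s hs
    have h2 := dB_lip (α 0) (α s)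
    have h3 := lip_dist hα (u := 0) (v := s) ⟨le_rfl, hM⟩ hs
    rw [zero_sub, abs_neg, abs_of_nonneg hs.1] at h3
    rw [hAdef]
    linarith
  have hhi : ∀ s ∈ Icc 0 M, dB (α s) ≤ s + ρ := by
    intro s hs
    have h2 := dB_lip (α s) (α 0)
    have h3 := lip_dist hα (u := s) (v := 0) hs ⟨le_rfl, hM⟩
    rw [sub_zero, abs_of_nonneg hs.1] at h3
    linarith
  have up : ∀ s t, 0 ≤ s → s ≤ t → t ≤ M →
      qhDist (α s) (α t) ≤ A * Real.log ((t + ρ) / (s + ρ)) := by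
    intro s t hs hst ht
    have hl := hα.mono (Icc_subset_Icc hs ht)
    refine (qhDist_le_path hpos hst hl).trans ?_
    rw [← integral_shift_inv (by linarith) hst, ← intervalIntegral.integral_const_mul]
    apply intervalIntegral.integral_mono_on hst (intble hpos hst hl)
      ((shift_intble (by linarith) hst).const_mul A)
    intro u hu
    have h1 := hlo u ⟨by linarith [hu.1], by linarith [hu.2]⟩
    have h2 := hpos (α u)
    have h3 : 0 < u + ρ := by linarith [hu.1]
    rw [mul_one_div, div_le_div_iff₀ h2 h3]
    linarith
  have low : ∀ s t, 0 ≤ s → s ≤ t → t ≤ M →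
      Real.log ((t + ρ) / (s + ρ)) - Real.log A ≤ qhDist (α s) (α t) := by
    intro s t hs hst ht
    refine le_trans ?_ (log_le_qhDist hpos hrc (α s) (α t))
    have h1 := hlo t ⟨by linarith, ht⟩
    have h2 := hhi s ⟨hs, by linarith⟩
    have p1 : 0 < s + ρ := by linarith
    have p2 : 0 < t + ρ := by linarith
    rw [← Real.log_div (by positivity) hA.ne']
    apply Real.log_le_log (by positivity)
    rw [div_div, div_le_div_iff₀ (by positivity) (hpos _)]
    calc (t + ρ) * dB (α s) ≤ (A * dB (α t)) * (s + ρ) :=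
          mul_le_mul h1 h2 (hpos _).le (mul_nonneg hA.le (hpos _).le)
      _ = dB (α t) * ((s + ρ) * A) := by ring
  set F := Real.log ((M + ρ) / ρ) with hFdef
  have hF : 0 ≤ F := Real.log_nonneg (by rw [le_div_iff₀ hρ0]; linarith)
  let σ : ℝ → ℝ := fun f => ρ * Real.exp f - ρ
  have hσF : σ F = M := by
    simp only [σ, hFdef]
    rw [Real.exp_log (by positivity)]
    field_simp
    ring
  have hσ0 : σ 0 = 0 := by simp [σ]
  have hσm : ∀ f g, f ≤ g → σ f ≤ σ g := by
    intro f g h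
    simp only [σ]
    have := Real.exp_le_exp.2 h
    nlinarith
  have hσl : ∀ f g, Real.log ((σ g + ρ) / (σ f + ρ)) = g - f := by
    intro f g
    simp only [σ, sub_add_cancel]
    rw [mul_div_mul_left _ _ hρ0.ne', ← Real.exp_sub, Real.log_exp]
  have rng : ∀ f ∈ Icc 0 F, 0 ≤ σ f ∧ σ f ≤ M := fun f hf =>
    ⟨hσ0 ▸ hσm 0 f hf.1, hσF ▸ hσm f F hf.2⟩
  obtain ⟨f, hf, hfz⟩ := near hpos hrc hδ hyp (A := A) (B := Real.log A) (F := F) hA.le hF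
    (P := fun f => α (σ f)) (z := z)
    (by
      intro f hf g hg
      rcases le_total f g with h | h
      · have := low _ _ (rng f hf).1 (hσm f g h) (rng g hg).2
        rw [hσl] at this
        rwa [abs_sub_comm, abs_of_nonneg (by linarith)]
      · have := low _ _ (rng g hg).1 (hσm g f h) (rng f hf).2
        rw [hσl] at this
        rwa [abs_of_nonneg (by linarith), qhDist_symm hpos hrc])
    (by
      intro f hf g hg
      rcases le_total f g with h | h
      · have := up _ _ (rng f hf).1 (hσm f g h) (rng g hg).2
        rw [hσl] at this
        rwa [abs_sub_comm, abs_of_nonneg (by linarith)]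
      · have := up _ _ (rng g hg).1 (hσm g f h) (rng f hf).2
        rw [hσl] at this
        rwa [abs_of_nonneg (by linarith), qhDist_symm hpos hrc])
    (by simpa only [hσ0, hσF] using hz)
  have hfz' : qhDist (α (σ f)) z ≤ HH a δ := hfz
  have t1 := qhDist_triangle hpos hrc (α 0) (α (σ f)) z
  have t2 := up 0 (σ f) le_rfl (rng f hf).1 (rng f hf).2
  have e0 := hσl 0 f
  rw [hσ0, sub_zero] at e0
  rw [e0] at t2
  have t3 := log_le_qhDist hpos hrc z (α (σ f))
  rw [qhDist_symm hpos hrc] at t3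
  have t4 := hlo (σ f) (rng f hf)
  have t5 : f ≤ Real.log (dB (α (σ f)) / ρ) + Real.log A := by
    refine e0.symm.le.trans ?_
    rw [zero_add, ← Real.log_mul (div_pos (hpos _) hρ0).ne' hA.ne']
    apply Real.log_le_log (div_pos (by linarith [(rng f hf).1]) hρ0)
    rw [div_mul_eq_mul_div]
    gcongr
    linarith
  rw [Real.log_div (hpos _).ne' (hpos _).ne'] at t3
  rw [Real.log_div (hpos _).ne' hρ0.ne'] at t5
  rw [Real.log_div (hpos _).ne' hρ0.ne']
  have t6 : f ≤ Real.log (dB z) - Real.log ρ + (HH a δ + Real.log A) := by linarith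
  have t7 := mul_le_mul_of_nonneg_left t6 hA.le
  unfold CC
  rw [← hAdef]
  linarith

/-- Exponential decay gives a length bound. -/
theorem decay {φ : ℝ → ℝ} (hφ : Continuous φ) (hp : ∀ s, 0 < φ s) {C A T : ℝ} (hA : 0 < A)
    (hT : 0 ≤ T)
    (h : ∀ s ∈ Icc 0 T, ∫ u in (0 : ℝ)..s, 1 / φ u ≤ A * Real.log (φ 0 / φ s) + C) :
    T ≤ A * Real.exp (C / A) * φ 0 := by
  have hc : Continuous fun u => 1 / φ u := continuous_const.div hφ fun u => (hp u).ne'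
  let τ : ℝ → ℝ := fun s => ∫ u in (0 : ℝ)..s, 1 / φ u
  have hτ : ∀ s, HasDerivAt τ (1 / φ s) s := fun s =>
    intervalIntegral.integral_hasDerivAt_right (hc.intervalIntegrable _ _)
      (hc.stronglyMeasurableAtFilter _ _) hc.continuousAt
  set B := A * Real.exp (C / A) * φ 0 with hB
  let g : ℝ → ℝ := fun s => s + B * Real.exp (-τ s / A)
  have hg : ∀ s, HasDerivAt g (1 + B * (Real.exp (-τ s / A) * (-(1 / φ s) / A))) s := by
    intro s
    exact (hasDerivAt_id s).add ((((hτ s).neg.div_const A).exp).const_mul B)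
  have hanti : AntitoneOn g (Icc 0 T) := by
    apply antitoneOn_of_deriv_nonpos (convex_Icc 0 T)
    · exact fun s _ => (hg s).continuousAt.continuousWithinAt
    · exact fun s _ => (hg s).differentiableAt.differentiableWithinAt
    · intro s hs
      rw [interior_Icc] at hs
      rw [(hg s).deriv]
      have h1 := h s ⟨hs.1.le, hs.2.le⟩
      change τ s ≤ _ at h1
      have h2 : Real.log (φ s) ≤ Real.log (φ 0) + (C / A + -τ s / A) := by
        rw [Real.log_div (hp _).ne' (hp _).ne'] at h1
        have : (C / A + -τ s / A) * A = C - τ s := by field_simp; ring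
        by_contra hcon
        push Not at hcon
        nlinarith
      have h3 : φ s ≤ φ 0 * (Real.exp (C / A) * Real.exp (-τ s / A)) := by
        have := Real.exp_le_exp.2 h2
        rwa [Real.exp_add, Real.exp_log (hp _), Real.exp_log (hp _), Real.exp_add] at this
      have h4 : B * (Real.exp (-τ s / A) * (-(1 / φ s) / A)) =
          -(φ 0 * (Real.exp (C / A) * Real.exp (-τ s / A)) / φ s) := by
        rw [hB]
        have := (hp s).ne'
        field_simp
      rw [h4]
      have := (one_le_div (hp s)).2 h3
      linarith
  have hfin := hanti ⟨le_rfl, hT⟩ ⟨hT, le_rfl⟩ hT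
  have hτ0 : τ 0 = 0 := by simp [τ]
  simp only [g, hτ0] at hfin
  have hB0 : 0 < B := by have := hp 0; positivity
  have : 0 < B * Real.exp (-τ T / A) := by positivity
  simp at hfin
  linarith

/-- The three-point alternative for points on a geodesic. -/
theorem alternative (hpos : ∀ x : D, 0 < dB x) (hrc : RectConnected D) {a δ : ℝ} (ha : 1 ≤ a)
    (hδ : 0 ≤ δ) (hyp : QHHyperbolic D δ) (hJ : IsJohn D a) {u v z : D}
    (hz : gromovProd u v z = 0) :
    qhDist u z ≤ (2 * a + 1) * Real.log (dB z / dB u) + CC a δ ∨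
    qhDist v z ≤ (2 * a + 1) * Real.log (dB z / dB v) + CC a δ := by
  obtain ⟨c, hc⟩ := hJ u v
  have hL := c.hL
  have h := hyp u (c.γ (c.L / 2)) v z
  rw [hz, sub_le_iff_le_add, zero_add, min_le_iff] at h
  rcases h with h | h
  · left
    have := half hpos hrc ha hδ hyp (M := c.L / 2) (by linarith) (α := c.γ)
      (c.lip.mono (Icc_subset_Icc le_rfl (by linarith)))
      (by
        intro s hs
        have := hc s ⟨hs.1, by linarith [hs.2]⟩
        rwa [min_eq_left (by linarith [hs.2])] at this)
      (z := z) (by rw [c.h0]; exact h)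
    rwa [c.h0] at this
  · right
    have := half hpos hrc ha hδ hyp (M := c.L / 2) (by linarith) (α := fun s => c.γ (c.L - s))
      (by
        apply lip_of_dist
        intro p hp q hq hpq
        have := lip_dist c.lip (u := c.L - p) (v := c.L - q)
          ⟨by linarith [hp.2], by linarith [hp.1]⟩
          ⟨by linarith [hq.2], by linarith [hq.1]⟩
        rw [abs_of_nonneg (by linarith)] at this
        linarith)
      (by
        intro s hs
        have := hc (c.L - s) ⟨by linarith [hs.2], by linarith [hs.1]⟩
        rwa [min_eq_right (by linarith [hs.2]), sub_sub_cancel] at this)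
      (z := z) (by
        have e : c.L - c.L / 2 = c.L / 2 := by ring
        simp only [sub_zero, e, c.h1]
        have : gromovProd v (c.γ (c.L / 2)) z = gromovProd (c.γ (c.L / 2)) v z := by
          unfold gromovProd
          rw [qhDist_symm hpos hrc v (c.γ (c.L / 2))]
          ring
        rw [this]
        exact h)
    simpa only [sub_zero, c.h1] using this

theorem cone (hpos : ∀ x : D, 0 < dB x) (hrc : RectConnected D) {a δ : ℝ} (ha : 1 ≤ a)
    (hδ : 0 ≤ δ) (hyp : QHHyperbolic D δ) (hJ : IsJohn D a) {x y : D} (c : Curve D x y)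
    (hg : c.IsQHGeodesic) :
    c.IsConeArc ((2 * a + 1) * Real.exp (CC a δ / (2 * a + 1))) := by
  intro t ht
  have hL := c.hL
  have hA : 0 < 2 * a + 1 := by linarith
  have hk : ∀ p q, 0 ≤ p → p ≤ q → q ≤ c.L →
      ∫ u in p..q, 1 / dB (c.γ u) = qhDist (c.γ p) (c.γ q) := fun p q h0 h1 h2 =>
    hg p q ⟨h0, h1.trans h2⟩ ⟨h0.trans h1, h2⟩ h1
  have alt : ∀ p q, 0 ≤ p → p ≤ t → t ≤ q → q ≤ c.L →
      qhDist (c.γ p) (c.γ t) ≤ (2 * a + 1) * Real.log (dB (c.γ t) / dB (c.γ p)) + CC a δ ∨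
      qhDist (c.γ q) (c.γ t) ≤ (2 * a + 1) * Real.log (dB (c.γ t) / dB (c.γ q)) + CC a δ := by
    intro p q h0 h1 h2 h3
    apply alternative hpos hrc ha hδ hyp hJ
    unfold gromovProd
    rw [qhDist_symm hpos hrc (c.γ q), ← hk p t h0 h1 ht.2, ← hk t q ht.1 h2 h3,
      ← hk p q h0 (h1.trans h2) h3,
      intervalIntegral.integral_add_adjacent_intervals
        (intble hpos h1 (c.lip.mono (Icc_subset_Icc h0 ht.2)))
        (intble hpos h2 (c.lip.mono (Icc_subset_Icc ht.1 h3)))]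
    simp
  let G : ℝ → D := fun u => c.γ (projIcc 0 c.L hL u)
  have hGc : Continuous G :=
    c.lip.continuousOn.domRestrict.comp continuous_projIcc
  have hG : ∀ u ∈ Icc 0 c.L, G u = c.γ u := fun u hu => by
    simp only [G, projIcc_of_mem hL hu]
  by_cases hall : ∀ p ∈ Icc 0 t,
      qhDist (c.γ p) (c.γ t) ≤ (2 * a + 1) * Real.log (dB (c.γ t) / dB (c.γ p)) + CC a δ
  · refine (min_le_left _ _).trans ?_
    have := decay (φ := fun s => dB (G (t - s))) (dB_cont.comp (hGc.comp (by fun_prop)))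
      (fun s => hpos _) (C := CC a δ) (A := 2 * a + 1) (T := t) hA ht.1 (by
        intro s hs
        have m1 : t - s ∈ Icc 0 c.L := ⟨by linarith [hs.2], by linarith [hs.1, ht.2]⟩
        have h1 := hall (t - s) ⟨by linarith [hs.2], by linarith [hs.1]⟩
        rw [sub_zero, hG t ht, hG _ m1]
        refine le_trans (le_of_eq ?_) h1
        rw [intervalIntegral.integral_comp_sub_left (fun u => 1 / dB (G u)), sub_zero,
          ← hk _ _ m1.1 (by linarith [hs.1]) ht.2]
        apply intervalIntegral.integral_congr
        intro u hu
        rw [uIcc_of_le (by linarith [hs.1])] at hu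
        simp only [hG u ⟨by linarith [hu.1, m1.1], by linarith [hu.2, ht.2]⟩])
    simpa only [sub_zero, hG t ht] using this
  · push Not at hall
    obtain ⟨p, hp, hpn⟩ := hall
    have hall : ∀ q, t ≤ q → q ≤ c.L → _ := fun q h2 h3 =>
      (alt p q hp.1 hp.2 h2 h3).resolve_left (not_le.2 hpn)
    refine (min_le_right _ _).trans ?_
    have := decay (φ := fun s => dB (G (t + s))) (dB_cont.comp (hGc.comp (by fun_prop)))
      (fun s => hpos _) (C := CC a δ) (A := 2 * a + 1) (T := c.L - t) hA (by linarith [ht.2]) (by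
        intro s hs
        have m1 : t + s ∈ Icc 0 c.L := ⟨by linarith [hs.1, ht.1], by linarith [hs.2]⟩
        have h1 := hall (t + s) (by linarith [hs.1]) (by linarith [hs.2])
        rw [add_zero, hG t ht, hG _ m1]
        refine le_trans (le_of_eq ?_) h1
        rw [intervalIntegral.integral_comp_add_left (fun u => 1 / dB (G u)), add_zero,
          qhDist_symm hpos hrc, ← hk _ _ ht.1 (by linarith [hs.1]) m1.2]
        apply intervalIntegral.integral_congr
        intro u hu
        rw [uIcc_of_le (by linarith [hs.1])] at hu
        simp only [hG u ⟨by linarith [hu.1, ht.1], by linarith [hu.2, m1.2]⟩])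
    simpa only [add_zero, hG t ht] using this

/-- In a proper subdomain of a Euclidean space the boundary distance is positive. -/
theorem dB_pos {E : Type*} [NormedAddCommGroup E] [NormedSpace ℝ E] [CompleteSpace E]
    {Ω : Set E} (ho : IsOpen Ω) (hne : Ω.Nonempty) (hu : Ω ≠ univ) (x : Ω) : 0 < dB x := by
  let j : UniformSpace.Completion Ω → E := UniformSpace.Completion.extension Subtype.val
  have hj : Isometry j := isometry_subtype_coe.completion_extension
  have hjc : ∀ w : Ω, j (w : UniformSpace.Completion Ω) = w := fun w =>
    UniformSpace.Completion.extension_coe isometry_subtype_coe.uniformContinuous w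
  have hrange : Set.range ((↑) : Ω → UniformSpace.Completion Ω) = j ⁻¹' Ω := by
    ext ξ
    constructor
    · rintro ⟨w, rfl⟩
      rw [mem_preimage, hjc]
      exact w.2
    · intro h
      exact ⟨⟨j ξ, h⟩, hj.injective (hjc _)⟩
  have hopen : IsOpen (Set.range ((↑) : Ω → UniformSpace.Completion Ω)) := by
    rw [hrange]
    exact ho.preimage hj.continuous
  have hnon : ((Set.range ((↑) : Ω → UniformSpace.Completion Ω))ᶜ).Nonempty := by
    rw [nonempty_compl]
    intro hr
    have hcomp : CompleteSpace Ω :=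
      ((UniformSpace.Completion.isUniformInducing_coe Ω).completeSpace_congr
        (range_eq_univ.1 hr)).2 inferInstance
    have hcl : IsClosed Ω := (completeSpace_coe_iff_isComplete.1 hcomp).isClosed
    exact hu (IsClopen.eq_univ ⟨hcl, ho⟩ hne)
  unfold dB
  rw [← hopen.isClosed_compl.notMem_iff_infDist_pos hnon]
  simp

end QH

/-- every quasihyperbolic geodesic in an `a`-John, `δ`-hyperbolic
proper subdomain of `ℝⁿ` is a `b`-cone arc with `b = b(a, δ)`. -/
theorem stmt10 :
    ∀ a δ : ℝ, 1 ≤ a → 0 ≤ δ → ∃ b : ℝ,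
      ∀ (n : ℕ) (Ω : Set (EuclideanSpace ℝ (Fin n))),
        IsOpen Ω → IsConnected Ω → Ω ≠ Set.univ →
        IsJohn ↥Ω a → QHHyperbolic ↥Ω δ →
        ∀ (x y : ↥Ω) (γ : Curve ↥Ω x y), γ.IsQHGeodesic → γ.IsConeArc b := by
  intro a δ ha hδ
  refine ⟨(2 * a + 1) * Real.exp (QH.CC a δ / (2 * a + 1)), ?_⟩
  intro n Ω ho hconn hu hJ hyp x y γ hγ
  exact QH.cone (QH.dB_pos ho hconn.nonempty hu) (fun u v => ⟨(hJ u v).choose⟩) ha hδ hyp hJ γ hγ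
end
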